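/- Let a ≤ b be real numbers and let r : ℝ → ℝ³ be continuously differentiable (C¹) on [a, b], with values in Euclidean 3-space. Then the length of the curve r on [a, b], defined as the supremum over all partitions a = t₀ < t₁ < … < tₙ = b of the polygonal lengths Σᵢ ‖r(tᵢ) − r(tᵢ₋₁)‖, equals ∫ₐᵇ ‖r′(t)‖ dt. -/

import Mathlib

section CurveLength

variable {E : Type*} [NormedAddCommGroup E]

theorem Fin.sum_succ_sub_castSucc {M : Type*} [AddCommGroup M] {n : ℕ} (f : Fin (n + 1) → M) :
    ∑ i : Fin n, (f i.succ - f i.castSucc) = f (Fin.last n) - f 0 := by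
  induction n with
  | zero => simp
  | succ n ih =>
    have h := ih fun i => f i.castSucc
    simp only [Fin.castSucc_zero] at h
    rw [Fin.sum_univ_castSucc]
    simp only [Fin.succ_castSucc, h, Fin.succ_last]
    abel

theorem ContinuousOn.intervalIntegrable_norm_of_mem_Icc {f : ℝ → E} {a b u v : ℝ}
    (hf : ContinuousOn f (Set.Icc a b)) (hu : u ∈ Set.Icc a b) (hv : v ∈ Set.Icc a b) :
    IntervalIntegrable (fun t => ‖f t‖) MeasureTheory.volume u v :=
  (hf.norm.mono (Set.uIcc_subset_Icc hu hv)).intervalIntegrable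

variable [NormedSpace ℝ E] [CompleteSpace E]

theorem integral_eq_sub_of_hasDerivWithinAt_Icc {r r' : ℝ → E} {u v : ℝ} (huv : u ≤ v)
    (hderiv : ∀ t ∈ Set.Icc u v, HasDerivWithinAt r (r' t) (Set.Icc u v) t)
    (hcont : ContinuousOn r' (Set.Icc u v)) :
    ∫ t in u..v, r' t = r v - r u :=
  intervalIntegral.integral_eq_sub_of_hasDerivAt_of_le huv
    (fun t ht => (hderiv t ht).continuousWithinAt)
    (fun t ht => (hderiv t (Set.Ioo_subset_Icc_self ht)).hasDerivAt (Icc_mem_nhds ht.1 ht.2))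
    (hcont.intervalIntegrable_of_Icc huv)

theorem norm_sub_le_integral_norm_of_hasDerivWithinAt_Icc {r r' : ℝ → E} {u v : ℝ} (huv : u ≤ v)
    (hderiv : ∀ t ∈ Set.Icc u v, HasDerivWithinAt r (r' t) (Set.Icc u v) t)
    (hcont : ContinuousOn r' (Set.Icc u v)) :
    ‖r v - r u‖ ≤ ∫ t in u..v, ‖r' t‖ := by
  rw [← integral_eq_sub_of_hasDerivWithinAt_Icc huv hderiv hcont]
  exact intervalIntegral.norm_integral_le_integral_norm huv

/-- If the derivative stays within `ε` of its initial value, then the chord is almost as long as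
the arc. -/
theorem integral_norm_le_norm_sub_add {r r' : ℝ → E} {u v ε : ℝ} (huv : u ≤ v)
    (hderiv : ∀ t ∈ Set.Icc u v, HasDerivWithinAt r (r' t) (Set.Icc u v) t)
    (hcont : ContinuousOn r' (Set.Icc u v))
    (hε : ∀ t ∈ Set.Icc u v, ‖r' t - r' u‖ ≤ ε) :
    ∫ t in u..v, ‖r' t‖ ≤ ‖r v - r u‖ + 2 * ε * (v - u) := by
  have hint := hcont.intervalIntegrable_of_Icc (μ := MeasureTheory.volume) huv
  have harc : ∫ t in u..v, ‖r' t‖ ≤ (v - u) * (‖r' u‖ + ε) := by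
    have h := intervalIntegral.integral_mono_on (g := fun _ => ‖r' u‖ + ε) huv hint.norm
      intervalIntegrable_const fun t ht => by
        linarith [hε t ht, norm_sub_norm_le (r' t) (r' u)]
    simpa [mul_add] using h
  have hchord : ‖(r v - r u) - (v - u) • r' u‖ ≤ ε * (v - u) := by
    have h : ∫ t in u..v, (r' t - r' u) = (r v - r u) - (v - u) • r' u := by
      rw [intervalIntegral.integral_sub hint intervalIntegrable_const,
        integral_eq_sub_of_hasDerivWithinAt_Icc huv hderiv hcont,
        intervalIntegral.integral_const]
    rw [← h, ← abs_of_nonneg (sub_nonneg.2 huv)]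
    refine intervalIntegral.norm_integral_le_of_norm_le_const fun t ht => hε t ?_
    rw [Set.uIoc_of_le huv] at ht
    exact Set.Ioc_subset_Icc_self ht
  have hnorm : (v - u) * ‖r' u‖ = ‖(v - u) • r' u‖ := by
    rw [norm_smul, Real.norm_of_nonneg (sub_nonneg.2 huv)]
  have htri := norm_sub_norm_le ((v - u) • r' u) (r v - r u)
  rw [norm_sub_rev ((v - u) • r' u) (r v - r u)] at htri
  linarith

theorem sum_norm_sub_le_integral_norm {r r' : ℝ → E} {a b : ℝ}
    (hderiv : ∀ t ∈ Set.Icc a b, HasDerivWithinAt r (r' t) (Set.Icc a b) t)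
    (hcont : ContinuousOn r' (Set.Icc a b)) {n : ℕ} {t : Fin (n + 1) → ℝ}
    (ht : Monotone t) (h0 : t 0 = a) (hn : t (Fin.last n) = b) :
    ∑ i : Fin n, ‖r (t i.succ) - r (t i.castSucc)‖ ≤ ∫ s in a..b, ‖r' s‖ := by
  have hmem : ∀ i, t i ∈ Set.Icc a b := fun i =>
    ⟨h0 ▸ ht (Fin.zero_le i), hn ▸ ht (Fin.le_last i)⟩
  have ha : a ∈ Set.Icc a b := h0 ▸ hmem 0
  calc ∑ i : Fin n, ‖r (t i.succ) - r (t i.castSucc)‖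
      ≤ ∑ i : Fin n, ((∫ s in a..t i.succ, ‖r' s‖) - ∫ s in a..t i.castSucc, ‖r' s‖) := by
        refine Finset.sum_le_sum fun i _ => ?_
        rw [intervalIntegral.integral_interval_sub_left
          (hcont.intervalIntegrable_norm_of_mem_Icc ha (hmem _))
          (hcont.intervalIntegrable_norm_of_mem_Icc ha (hmem _))]
        have hsub := Set.Icc_subset_Icc (hmem i.castSucc).1 (hmem i.succ).2
        exact norm_sub_le_integral_norm_of_hasDerivWithinAt_Icc
          (ht i.castSucc_le_succ)
          (fun s hs => (hderiv s (hsub hs)).mono hsub) (hcont.mono hsub)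
    _ = ∫ s in a..b, ‖r' s‖ := by
        rw [Fin.sum_succ_sub_castSucc fun i => ∫ s in a..t i, ‖r' s‖, h0, hn]
        simp

theorem integral_norm_le_sum_norm_sub_add {r r' : ℝ → E} {a b ε : ℝ}
    (hderiv : ∀ t ∈ Set.Icc a b, HasDerivWithinAt r (r' t) (Set.Icc a b) t)
    (hcont : ContinuousOn r' (Set.Icc a b)) {n : ℕ} {t : Fin (n + 1) → ℝ}
    (ht : Monotone t) (h0 : t 0 = a) (hn : t (Fin.last n) = b)
    (hε : ∀ i : Fin n, ∀ s ∈ Set.Icc (t i.castSucc) (t i.succ), ‖r' s - r' (t i.castSucc)‖ ≤ ε) :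
    ∫ s in a..b, ‖r' s‖ ≤
      ∑ i : Fin n, ‖r (t i.succ) - r (t i.castSucc)‖ + 2 * ε * (b - a) := by
  have hmem : ∀ i, t i ∈ Set.Icc a b := fun i =>
    ⟨h0 ▸ ht (Fin.zero_le i), hn ▸ ht (Fin.le_last i)⟩
  have ha : a ∈ Set.Icc a b := h0 ▸ hmem 0
  calc ∫ s in a..b, ‖r' s‖
      = ∑ i : Fin n, ((∫ s in a..t i.succ, ‖r' s‖) - ∫ s in a..t i.castSucc, ‖r' s‖) := by
        rw [Fin.sum_succ_sub_castSucc fun i => ∫ s in a..t i, ‖r' s‖, h0, hn]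
        simp
    _ ≤ ∑ i : Fin n, (‖r (t i.succ) - r (t i.castSucc)‖ +
          2 * ε * (t i.succ - t i.castSucc)) := by
        refine Finset.sum_le_sum fun i _ => ?_
        rw [intervalIntegral.integral_interval_sub_left
          (hcont.intervalIntegrable_norm_of_mem_Icc ha (hmem _))
          (hcont.intervalIntegrable_norm_of_mem_Icc ha (hmem _))]
        have hsub := Set.Icc_subset_Icc (hmem i.castSucc).1 (hmem i.succ).2
        exact integral_norm_le_norm_sub_add (ht i.castSucc_le_succ)
          (fun s hs => (hderiv s (hsub hs)).mono hsub) (hcont.mono hsub) (hε i)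
    _ = _ := by
        rw [Finset.sum_add_distrib, ← Finset.mul_sum, Fin.sum_succ_sub_castSucc, h0, hn]

theorem exists_strictMono_partition_lt {a b δ : ℝ} (hab : a ≤ b) (hδ : 0 < δ) :
    ∃ (n : ℕ) (t : Fin (n + 1) → ℝ), StrictMono t ∧ t 0 = a ∧ t (Fin.last n) = b ∧
      ∀ i : Fin n, t i.succ - t i.castSucc < δ := by
  rcases hab.eq_or_lt with rfl | hlt
  · exact ⟨0, fun _ => a, Subsingleton.strictMono (α := Fin 1) _, rfl, rfl, fun i => i.elim0⟩
  obtain ⟨n, hn⟩ := exists_nat_gt ((b - a) / δ)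
  have hpos : (0 : ℝ) < n := (div_pos (sub_pos.2 hlt) hδ).trans hn
  have hstep : 0 < (b - a) / n := div_pos (sub_pos.2 hlt) hpos
  refine ⟨n, fun i => a + (i : ℕ) * ((b - a) / n), fun i j hij => ?_, by simp, ?_, fun i => ?_⟩
  · have : ((i : ℕ) : ℝ) < (j : ℕ) := by exact_mod_cast hij
    dsimp only
    gcongr
  · simp only [Fin.val_last]
    field_simp
    ring
  · have h : (b - a) / n < δ := by
      rw [div_lt_iff₀ hδ] at hn
      rw [div_lt_iff₀ hpos]
      linarith
    simp only [Fin.val_succ, Fin.val_castSucc, Nat.cast_add, Nat.cast_one]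
    linarith

end CurveLength


/-- the length of a C¹ curve r on [a, b], defined as the supremum of
the lengths of inscribed polygonal lines over all partitions a = t₀ < t₁ < … < tₙ = b,
equals ∫ₐᵇ ‖r′(t)‖ dt. -/
theorem length_of_C1_curve_eq_integral_norm_deriv
    (a b : ℝ) (hab : a ≤ b)
    (r r' : ℝ → EuclideanSpace ℝ (Fin 3))
    (hderiv : ∀ t ∈ Set.Icc a b, HasDerivWithinAt r (r' t) (Set.Icc a b) t)
    (hcont : ContinuousOn r' (Set.Icc a b)) :
    sSup {ℓ : ℝ | ∃ (n : ℕ) (t : Fin (n + 1) → ℝ),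
        StrictMono t ∧ t 0 = a ∧ t (Fin.last n) = b ∧
        ℓ = ∑ i : Fin n, ‖r (t i.succ) - r (t i.castSucc)‖} =
      ∫ t in a..b, ‖r' t‖ := by
  refine IsLUB.csSup_eq ⟨?_, fun M hM => ?_⟩ ?_
  · rintro ℓ ⟨n, t, ht, h0, hn, rfl⟩
    exact sum_norm_sub_le_integral_norm hderiv hcont ht.monotone h0 hn
  · refine le_of_forall_pos_le_add fun η hη => ?_
    have hlen : 0 < 2 * (b - a + 1) := by linarith
    obtain ⟨δ, hδ, hunif⟩ := Metric.uniformContinuousOn_iff.1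
      (isCompact_Icc.uniformContinuousOn_of_continuous hcont)
      (η / (2 * (b - a + 1))) (div_pos hη hlen)
    obtain ⟨n, t, ht, h0, hn, hmesh⟩ := exists_strictMono_partition_lt hab hδ
    have hmem : ∀ i, t i ∈ Set.Icc a b := fun i =>
      ⟨h0 ▸ ht.monotone (Fin.zero_le i), hn ▸ ht.monotone (Fin.le_last i)⟩
    have happrox := integral_norm_le_sum_norm_sub_add hderiv hcont ht.monotone h0 hn
      (ε := η / (2 * (b - a + 1))) fun i s hs => by
        rw [← dist_eq_norm]
        refine (hunif s ⟨(hmem _).1.trans hs.1, hs.2.trans (hmem _).2⟩ _ (hmem _) ?_).le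
        rw [Real.dist_eq, abs_of_nonneg (sub_nonneg.2 hs.1)]
        linarith [hs.2, hmesh i]
    have hM' := hM ⟨n, t, ht, h0, hn, rfl⟩
    have herr : 2 * (η / (2 * (b - a + 1))) * (b - a) ≤ η := by
      have h1 : η / (2 * (b - a + 1)) * (2 * (b - a + 1)) = η := div_mul_cancel₀ _ hlen.ne'
      linarith [div_pos hη hlen]
    linarith
  · obtain ⟨n, t, ht, h0, hn, -⟩ := exists_strictMono_partition_lt hab one_pos
    exact ⟨_, n, t, ht, h0, hn, rfl⟩
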